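/- arXiv:2505.08024 — 4 statements merged into one kernel-verified Lean document; each statement's English description precedes it below -/
import Mathlib

section
/- For all natural numbers n, k and i, the coefficient of q^i in the q-binomial coefficient binom(n+k,k)_q equals the number of partitions of i having at most n parts, all of whose parts have size at most k. -/
open Polynomial

/-- The `q`-integer `[m]_q = 1 + q + q^2 + ⋯ + q^(m-1)` in `ℤ[q]`. -/
noncomputable def qInt (m : ℕ) : Polynomial ℤ := ∑ i ∈ Finset.range m, X ^ i

/-- The `q`-factorial `[m]!_q = [m]_q · [m-1]_q ⋯ [1]_q`, with `[0]!_q = 1`. -/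
noncomputable def qFact : ℕ → Polynomial ℤ
  | 0 => 1
  | m + 1 => qInt (m + 1) * qFact m

lemma qInt_add (a b : ℕ) : qInt (a + b) = qInt a + X ^ a * qInt b := by
  simp only [qInt, Finset.sum_range_add, Finset.mul_sum, pow_add]

lemma qInt_succ_ne_zero (m : ℕ) : qInt (m + 1) ≠ 0 := by
  intro h
  have h0 := congrArg (eval 0) h
  simp [qInt, Finset.sum_range_succ', eval_finsetSum] at h0

lemma qFact_ne_zero (m : ℕ) : qFact m ≠ 0 := by
  induction m with
  | zero => simp [qFact]
  | succ m ih => exact mul_ne_zero (qInt_succ_ne_zero m) ih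

/-- The multisets of positive integers of sum `i`, with at most `n` elements, all at most `k`. -/
def boxPartitions (n k i : ℕ) : Set (Multiset ℕ) :=
  {s | (s.sum = i ∧ ∀ j ∈ s, 0 < j) ∧ s.card ≤ n ∧ ∀ j ∈ s, j ≤ k}

lemma parts_image_eq_boxPartitions (n k i : ℕ) :
    Nat.Partition.parts '' {p : Nat.Partition i | p.parts.card ≤ n ∧ ∀ j ∈ p.parts, j ≤ k} =
      boxPartitions n k i := by
  ext s
  constructor
  · rintro ⟨p, hp, rfl⟩
    exact ⟨⟨p.parts_sum, fun _ hj => p.parts_pos hj⟩, hp⟩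
  · rintro ⟨⟨hsum, hpos⟩, hs⟩
    exact ⟨⟨s, fun {j} hj => hpos j hj, hsum⟩, hs, rfl⟩

lemma finite_boxPartitions (n k i : ℕ) : (boxPartitions n k i).Finite := by
  rw [← parts_image_eq_boxPartitions]
  exact (Set.toFinite _).image _

lemma ncard_boxPartitions (n k i : ℕ) :
    (boxPartitions n k i).ncard =
      Fintype.card {p : Nat.Partition i // p.parts.card ≤ n ∧ ∀ j ∈ p.parts, j ≤ k} := by
  rw [← parts_image_eq_boxPartitions,
    Set.ncard_image_of_injective _ fun _ _ h => Nat.Partition.ext h, ← Nat.card_eq_fintype_card]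
  rfl

lemma ncard_boxPartitions_of_eq_zero {n k : ℕ} (h : n = 0 ∨ k = 0) (i : ℕ) :
    (boxPartitions n k i).ncard = if i = 0 then 1 else 0 := by
  have key : ∀ s ∈ boxPartitions n k i, s = 0 := by
    rintro s ⟨⟨-, hpos⟩, hcard, hle⟩
    rcases h with rfl | rfl
    · simpa using hcard
    · exact Multiset.eq_zero_of_forall_notMem fun j hj =>
        (hpos j hj).not_ge (hle j hj)
  split_ifs with hi
  · subst hi
    rw [Set.ncard_eq_one]
    refine ⟨0, Set.eq_singleton_iff_unique_mem.2 ⟨?_, key⟩⟩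
    simp [boxPartitions]
  · rw [Set.ncard_eq_zero (finite_boxPartitions n k i), Set.eq_empty_iff_forall_notMem]
    intro s hs
    have h0 := hs.1.1
    rw [key s hs, Multiset.sum_zero] at h0
    exact hi h0.symm

lemma boxPartitions_succ_succ_of_lt {n k i : ℕ} (h : i < k + 1) :
    boxPartitions (n + 1) (k + 1) i = boxPartitions (n + 1) k i := by
  ext s
  refine and_congr_right fun hs => and_congr_right fun _ => forall₂_congr fun j hj => ?_
  have := Multiset.le_sum_of_mem hj
  omega

lemma boxPartitions_succ_succ (n k i : ℕ) :
    boxPartitions (n + 1) (k + 1) (i + (k + 1)) =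
      boxPartitions (n + 1) k (i + (k + 1)) ∪
        Multiset.cons (k + 1) '' boxPartitions n (k + 1) i := by
  ext s
  constructor
  · rintro ⟨⟨hsum, hpos⟩, hcard, hle⟩
    by_cases hk : k + 1 ∈ s
    · obtain ⟨t, rfl⟩ := Multiset.exists_cons_of_mem hk
      rw [Multiset.sum_cons] at hsum
      rw [Multiset.card_cons] at hcard
      exact Or.inr ⟨t, ⟨⟨by omega, fun j hj => hpos j (Multiset.mem_cons_of_mem hj)⟩, by omega,
        fun j hj => hle j (Multiset.mem_cons_of_mem hj)⟩, rfl⟩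
    · refine Or.inl ⟨⟨hsum, hpos⟩, hcard, fun j hj => ?_⟩
      exact Nat.le_of_lt_succ ((hle j hj).lt_of_ne fun h => hk (h ▸ hj))
  · rintro (⟨hs, hcard, hle⟩ | ⟨t, ⟨⟨hsum, hpos⟩, hcard, hle⟩, rfl⟩)
    · exact ⟨hs, hcard, fun j hj => (hle j hj).trans k.le_succ⟩
    · refine ⟨⟨?_, ?_⟩, ?_, ?_⟩
      · rw [Multiset.sum_cons, hsum, add_comm]
      · simpa using hpos
      · simpa using hcard
      · simpa using hle

lemma ncard_boxPartitions_succ_succ (n k i : ℕ) :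
    (boxPartitions (n + 1) (k + 1) i).ncard =
      (boxPartitions (n + 1) k i).ncard +
        if k + 1 ≤ i then (boxPartitions n (k + 1) (i - (k + 1))).ncard else 0 := by
  split_ifs with h
  · obtain ⟨i, rfl⟩ := Nat.exists_eq_add_of_le' h
    rw [boxPartitions_succ_succ, Set.ncard_union_eq ?_ (finite_boxPartitions _ _ _)
      ((finite_boxPartitions _ _ _).image _),
      Set.ncard_image_of_injective _ fun _ _ => (Multiset.cons_inj_right _).1, Nat.add_sub_cancel]
    rw [Set.disjoint_right]
    rintro _ ⟨t, -, rfl⟩ ⟨-, -, hle⟩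
    exact absurd (hle _ (Multiset.mem_cons_self _ _)) (by omega)
  · rw [boxPartitions_succ_succ_of_lt (not_le.1 h), add_zero]

/-- The Gaussian binomial `binom(n+k,k)_q`, defined by its `q`-Pascal recursion. -/
noncomputable def gaussBinom : ℕ → ℕ → Polynomial ℤ
  | 0, _ => 1
  | _ + 1, 0 => 1
  | n + 1, k + 1 => gaussBinom (n + 1) k + X ^ (k + 1) * gaussBinom n (k + 1)

lemma gaussBinom_mul_qFact_mul_qFact (n k : ℕ) :
    gaussBinom n k * qFact k * qFact n = qFact (n + k) := by
  induction n, k using gaussBinom.induct with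
  | case1 k => simp [gaussBinom, qFact]
  | case2 n => simp [gaussBinom, qFact]
  | case3 n k ih₁ ih₂ =>
    have h : qInt (n + 1 + (k + 1)) = qInt (k + 1) + X ^ (k + 1) * qInt (n + 1) := by
      rw [add_comm, qInt_add]
    have hs : qFact (n + 1 + (k + 1)) = qInt (n + 1 + (k + 1)) * qFact (n + 1 + k) := rfl
    have hn : qFact (n + 1) = qInt (n + 1) * qFact n := rfl
    have hk : qFact (k + 1) = qInt (k + 1) * qFact k := rfl
    rw [show n + (k + 1) = n + 1 + k by omega] at ih₂
    rw [hs, h, gaussBinom]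
    linear_combination qInt (k + 1) * ih₁ + X ^ (k + 1) * qInt (n + 1) * ih₂ +
      gaussBinom (n + 1) k * qFact (n + 1) * hk +
      X ^ (k + 1) * gaussBinom n (k + 1) * qFact (k + 1) * hn

lemma coeff_gaussBinom (n k i : ℕ) :
    (gaussBinom n k).coeff i = (boxPartitions n k i).ncard := by
  induction n, k using gaussBinom.induct generalizing i with
  | case1 k => simp [gaussBinom, ncard_boxPartitions_of_eq_zero, coeff_one]
  | case2 n => simp [gaussBinom, ncard_boxPartitions_of_eq_zero, coeff_one]
  | case3 n k ih₁ ih₂ =>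
    rw [gaussBinom, coeff_add, coeff_X_pow_mul', ih₁, ih₂, ncard_boxPartitions_succ_succ]
    push_cast
    rfl

/-- The coefficient of `q^i` in `binom(n+k,k)_q` counts partitions of `i` with at most `n`
parts, all of size at most `k`. -/
theorem qbinom_coeff_eq_card_partitions (n k i : ℕ) (P : Polynomial ℤ)
    (hP : P * qFact k * qFact n = qFact (n + k)) :
    P.coeff i =
      Fintype.card {p : Nat.Partition i // p.parts.card ≤ n ∧ ∀ j ∈ p.parts, j ≤ k} := by
  have h : P = gaussBinom n k := by
    rw [← gaussBinom_mul_qFact_mul_qFact] at hP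
    exact mul_right_cancel₀ (qFact_ne_zero k) (mul_right_cancel₀ (qFact_ne_zero n) hP)
  rw [h, coeff_gaussBinom, ncard_boxPartitions]
end

section
/- Let F be a finite field with q elements and let k ≤ n be natural numbers. Then the number of k-dimensional F-linear subspaces of F^n equals the q-binomial coefficient binom(n,k)_q evaluated at q = |F|; that is, the cardinality of {W : Submodule F (Fin n → F) | finrank F W = k} equals the integer obtained by evaluating binom(n,k)_q at the cardinality of F. -/
open Polynomial

theorem eval_qInt_mul_sub_one (m : ℕ) (x : ℤ) : (qInt m).eval x * (x - 1) = x ^ m - 1 := by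
  simp only [qInt, eval_finsetSum, eval_pow, eval_X]
  exact geom_sum_mul x m

theorem eval_qFact_pos (m : ℕ) {x : ℤ} (hx : 0 < x) : 0 < (qFact m).eval x := by
  induction m with
  | zero => simp [qFact]
  | succ m ih =>
    rw [qFact, eval_mul]
    refine mul_pos ?_ ih
    simp only [qInt, eval_finsetSum, eval_pow, eval_X]
    exact Finset.sum_pos (fun i _ => pow_pos hx i) (by simp)

theorem prod_pow_sub_pow_mul_eval_qFact (x : ℤ) (k m : ℕ) :
    (∏ i ∈ Finset.range k, (x ^ (m + k) - x ^ i)) * (qFact m).eval x =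
      (∏ i ∈ Finset.range k, x ^ i * (x - 1)) * (qFact (m + k)).eval x := by
  induction k generalizing m with
  | zero => simp
  | succ k ih =>
    have h := ih (m + 1)
    rw [show m + 1 + k = m + (k + 1) by ring] at h
    rw [qFact, eval_mul] at h
    rw [Finset.prod_range_succ, Finset.prod_range_succ]
    linear_combination x ^ k * (x - 1) * h -
      (∏ i ∈ Finset.range k, (x ^ (m + (k + 1)) - x ^ i)) * (qFact m).eval x * x ^ k *
        eval_qInt_mul_sub_one (m + 1) x

section LinearlyIndependentFamilies

variable {K V : Type*} [DivisionRing K] [AddCommGroup V] [Module K V]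

/-- A linearly independent family of `k` vectors amounts to a `k`-dimensional subspace together
with a linearly independent family of `k` vectors in it. -/
noncomputable def sigmaLinearIndependentEquiv [FiniteDimensional K V] (k : ℕ) :
    (Σ W : {W : Submodule K V // Module.finrank K W = k},
      {t : Fin k → W.1 // LinearIndependent K t}) ≃ {s : Fin k → V // LinearIndependent K s} :=
  Equiv.ofBijective
    (fun p => ⟨fun i => (p.2.1 i : V), p.2.2.map' p.1.1.subtype p.1.1.ker_subtype⟩) <| by
    have span_eq (W : Submodule K V) (hW : Module.finrank K W = k) (t : Fin k → W)
        (ht : LinearIndependent K t) :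
        Submodule.span K (Set.range fun i => (t i : V)) = W := by
      rw [show (fun i => (t i : V)) = W.subtype ∘ t from rfl, Set.range_comp,
        Submodule.span_image, ht.span_eq_top_of_card_eq_finrank' (by simp [hW]),
        Submodule.map_subtype_top]
    constructor
    · rintro ⟨⟨W, hW⟩, t, ht⟩ ⟨⟨W', hW'⟩, t', ht'⟩ h
      have h' : (fun i => (t i : V)) = fun i => (t' i : V) := congrArg Subtype.val h
      obtain rfl : W = W' := by rw [← span_eq W hW t ht, h', span_eq W' hW' t' ht']
      obtain rfl : t = t' := funext fun i => Subtype.ext (congrFun h' i)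
      rfl
    · rintro ⟨s, hs⟩
      exact ⟨⟨⟨Submodule.span K (Set.range s), by simpa using finrank_span_eq_card hs⟩,
        fun i => ⟨s i, Submodule.subset_span ⟨i, rfl⟩⟩, linearIndependent_span hs⟩, rfl⟩

theorem card_submodule_finrank_eq_mul_prod [Fintype K] [Finite V] {k : ℕ}
    (hk : k ≤ Module.finrank K V) :
    Nat.card {W : Submodule K V // Module.finrank K W = k} *
        ∏ i : Fin k, (Fintype.card K ^ k - Fintype.card K ^ i.val) =
      ∏ i : Fin k, (Fintype.card K ^ Module.finrank K V - Fintype.card K ^ i.val) := by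
  have := Fintype.ofFinite {W : Submodule K V // Module.finrank K W = k}
  rw [← card_linearIndependent hk, ← Nat.card_congr (sigmaLinearIndependentEquiv k),
    Nat.card_sigma, Finset.sum_congr rfl fun W _ => by
      rw [card_linearIndependent W.2.ge, W.2],
    Finset.sum_const, Finset.card_univ, smul_eq_mul, Nat.card_eq_fintype_card]

end LinearlyIndependentFamilies

theorem cast_prod_pow_sub_pow {q k n : ℕ} (hq : 0 < q) (hkn : k ≤ n) :
    ((∏ i : Fin k, (q ^ n - q ^ i.val) : ℕ) : ℤ) =
      ∏ i ∈ Finset.range k, ((q : ℤ) ^ n - (q : ℤ) ^ i) := by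
  rw [Finset.prod_range, Nat.cast_prod]
  refine Finset.prod_congr rfl fun i _ => ?_
  rw [Nat.cast_sub (Nat.pow_le_pow_right hq (i.2.le.trans hkn)), Nat.cast_pow, Nat.cast_pow]

/-- For a finite field `F` with `q` elements, the number of `k`-dimensional subspaces of
`F^n` is the `q`-binomial coefficient `binom(n,k)_q` evaluated at `q = |F|`. -/
theorem card_subspaces_eq_qbinom_eval (F : Type*) [Field F] [Fintype F] (n k : ℕ)
    (hkn : k ≤ n) (P : Polynomial ℤ)
    (hP : P * qFact k * qFact (n - k) = qFact n) :
    (Nat.card {W : Submodule F (Fin n → F) // Module.finrank F W = k} : ℤ) =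
      P.eval (Fintype.card F : ℤ) := by
  obtain ⟨m, rfl⟩ := Nat.exists_eq_add_of_le' hkn
  have hq : 1 < Fintype.card F := Fintype.one_lt_card
  have hcount := congrArg (Nat.cast : ℕ → ℤ) (card_submodule_finrank_eq_mul_prod (K := F)
    (V := Fin (m + k) → F) (k := k) (by simp))
  rw [Module.finrank_fin_fun, Nat.cast_mul, cast_prod_pow_sub_pow (by lia) le_rfl,
    cast_prod_pow_sub_pow (by lia) hkn] at hcount
  have heval := congrArg (eval (Fintype.card F : ℤ)) hP
  rw [Nat.add_sub_cancel, eval_mul, eval_mul] at heval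
  have hx : (1 : ℤ) < Fintype.card F := by exact_mod_cast hq
  generalize (Fintype.card F : ℤ) = x at *
  have hk := prod_pow_sub_pow_mul_eval_qFact x k 0
  rw [zero_add, qFact, eval_one, mul_one] at hk
  have hn := prod_pow_sub_pow_mul_eval_qFact x k m
  have hc : 0 < ∏ i ∈ Finset.range k, x ^ i * (x - 1) :=
    Finset.prod_pos fun i _ => mul_pos (pow_pos (by lia) i) (by lia)
  have hpos := mul_pos (mul_pos hc (eval_qFact_pos k (by lia : 0 < x)))
    (eval_qFact_pos m (by lia : 0 < x))
  refine mul_right_cancel₀ hpos.ne' ?_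
  rw [← hcount, ← heval, hk] at hn
  linear_combination hn
end

section
/- For all natural numbers n, k and m with m ≤ n, the coefficient of q^m in the q-binomial coefficient binom(n+k,k)_q equals p_k(m), the number of partitions of m all of whose parts have size at most k; in particular this coefficient does not depend on n. -/
open Polynomial

/-- `partnum k m = p_k(m)`, the number of partitions of `m` all of whose parts have size
at most `k`. -/
def partnum (k m : ℕ) : ℕ :=
  Fintype.card {p : Nat.Partition m // ∀ j ∈ p.parts, j ≤ k}

theorem qInt_mul_one_sub_X (m : ℕ) : qInt m * (1 - X) = 1 - X ^ m :=
  geom_sum_mul_neg X m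

theorem qFact_mul_one_sub_X_pow (m : ℕ) :
    qFact m * (1 - X) ^ m = ∏ i ∈ Finset.range m, (1 - X ^ (i + 1)) := by
  induction m with
  | zero => simp [qFact]
  | succ m ih =>
    rw [Finset.prod_range_succ, ← ih, ← qInt_mul_one_sub_X, qFact]
    ring

theorem one_sub_X_pow_succ_ne_zero (m : ℕ) : (1 - X ^ (m + 1) : ℤ[X]) ≠ 0 := fun h => by
  simpa using congrArg (Polynomial.eval 0) h

/-- The product formula `binom(n+k,k)_q ∏_{i=1}^k (1 - q^i) = ∏_{i=1}^k (1 - q^(n+i))`. -/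
theorem mul_prod_one_sub_X_pow_of_mul_qFact_eq {n k : ℕ} {P : ℤ[X]}
    (hP : P * qFact k * qFact n = qFact (n + k)) :
    P * ∏ i ∈ Finset.range k, (1 - X ^ (i + 1)) =
      ∏ i ∈ Finset.range k, (1 - X ^ (n + i + 1)) := by
  have hne : (∏ i ∈ Finset.range n, (1 - X ^ (i + 1)) : ℤ[X]) ≠ 0 :=
    Finset.prod_ne_zero_iff.2 fun i _ => one_sub_X_pow_succ_ne_zero i
  apply mul_left_cancel₀ hne
  rw [← Finset.prod_range_add (fun i => (1 - X ^ (i + 1) : ℤ[X])), ← qFact_mul_one_sub_X_pow,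
    ← qFact_mul_one_sub_X_pow, ← qFact_mul_one_sub_X_pow, ← hP]
  ring

theorem X_pow_dvd_prod_one_sub_X_pow_sub_one (n k : ℕ) :
    (X ^ (n + 1) : ℤ[X]) ∣ ∏ i ∈ Finset.range k, (1 - X ^ (n + i + 1)) - 1 := by
  induction k with
  | zero => simp
  | succ k ih =>
    have h : (X ^ (n + 1) : ℤ[X]) ∣ X ^ (n + k + 1) := pow_dvd_pow X (by omega)
    rw [Finset.prod_range_succ, mul_one_sub, sub_right_comm]
    exact ih.sub (h.mul_left _)

theorem partnum_eq_card_restricted (k m : ℕ) :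
    partnum k m = (Nat.Partition.restricted m (· ≤ k)).card := by
  rw [partnum, Fintype.card_subtype, Nat.Partition.restricted]

open scoped PowerSeries.WithPiTopology in
/-- The generating function of `partnum k` is the inverse of `∏_{i=1}^k (1 - q^i)`. -/
theorem mk_partnum_mul_prod_one_sub_X_pow (k : ℕ) :
    (PowerSeries.mk fun m => (partnum k m : ℤ)) *
      ∏ i ∈ Finset.range k, (1 - PowerSeries.X ^ (i + 1)) = 1 := by
  have h := Nat.Partition.hasProd_powerSeriesMk_card_restricted ℤ (· ≤ k)
  have h' := hasProd_prod_of_ne_finset_one (L := .unconditional ℕ) (s := Finset.range k)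
    (f := fun i => if i + 1 ≤ k then
      ∑' j : ℕ, (PowerSeries.X : PowerSeries ℤ) ^ ((i + 1) * j) else 1)
    fun i hi => if_neg (by simpa [Nat.succ_le_iff] using hi)
  simp_rw [partnum_eq_card_restricted, h.unique h', ← Finset.prod_mul_distrib]
  refine Finset.prod_eq_one fun i hi => ?_
  rw [if_pos (Nat.succ_le_of_lt (Finset.mem_range.1 hi))]
  simp_rw [pow_mul]
  exact PowerSeries.WithPiTopology.tsum_pow_mul_one_sub_of_constantCoeff_eq_zero (by simp)

/-- For `m ≤ n`, the coefficient of `q^m` in `binom(n+k,k)_q` equals `p_k(m)`, the number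
of partitions of `m` with all parts of size at most `k`; in particular it does not depend
on `n`. -/
theorem qbinom_coeff_initial (n k m : ℕ) (hmn : m ≤ n) (P : Polynomial ℤ)
    (hP : P * qFact k * qFact n = qFact (n + k)) :
    P.coeff m = partnum k m := by
  obtain ⟨R, hR⟩ := X_pow_dvd_prod_one_sub_X_pow_sub_one n k
  rw [← mul_prod_one_sub_X_pow_of_mul_qFact_eq hP, sub_eq_iff_eq_add] at hR
  have hR' := congrArg (Polynomial.coeToPowerSeries.ringHom (R := ℤ)) hR
  simp only [map_mul, map_prod, map_sub, map_one, map_pow, map_add,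
    Polynomial.coeToPowerSeries.ringHom_apply, Polynomial.coe_X] at hR'
  have hF := mk_partnum_mul_prod_one_sub_X_pow k
  set F := PowerSeries.mk fun m => (partnum k m : ℤ) with hFdef
  have hPF : (P : PowerSeries ℤ) = PowerSeries.X ^ (n + 1) * ((R : PowerSeries ℤ) * F) + F := by
    linear_combination F * hR' - (P : PowerSeries ℤ) * hF
  rw [← Polynomial.coeff_coe, hPF, map_add, PowerSeries.coeff_X_pow_mul', if_neg (by omega),
    zero_add, hFdef, PowerSeries.coeff_mk]
end

section
/- For every natural number k ≥ 1, the limit as m → ∞ of p_k(m) · k! · (k-1)! / m^{k-1} equals 1; equivalently, p_k(m) is asymptotic to m^{k-1}/(k!·(k-1)!). -/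
open Filter

theorem partnum_zero_succ (m : ℕ) : partnum 0 (m + 1) = 0 := by
  unfold partnum
  rw [Fintype.card_eq_zero_iff]
  refine ⟨fun ⟨p, hp⟩ => ?_⟩
  have hparts : p.parts = 0 := Multiset.eq_zero_of_forall_notMem fun j hj =>
    absurd (p.parts_pos hj) (by have := hp j hj; omega)
  have hsum := p.parts_sum
  rw [hparts, Multiset.sum_zero] at hsum
  omega

theorem partnum_zero_right (k : ℕ) : partnum k 0 = 1 := by
  unfold partnum
  rw [Fintype.card_eq_one_iff]
  exact ⟨⟨default, by simp⟩, fun p => Subtype.ext (Subsingleton.elim _ _)⟩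

theorem partnum_succ_of_lt {k m : ℕ} (h : m < k + 1) : partnum (k + 1) m = partnum k m := by
  unfold partnum
  refine Fintype.card_congr (Equiv.subtypeEquivRight fun p => ?_)
  refine forall₂_congr fun j hj => ?_
  have : j ≤ m := (Multiset.le_sum_of_mem hj).trans_eq p.parts_sum
  omega

/-- Adding a part of size `d` to a partition of `m`. -/
def Nat.Partition.consPart {m : ℕ} (d : ℕ) (hd : 0 < d) (p : Nat.Partition m) :
    Nat.Partition (m + d) where
  parts := d ::ₘ p.parts
  parts_pos := by
    intro i hi
    rcases Multiset.mem_cons.1 hi with rfl | hi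
    exacts [hd, p.parts_pos hi]
  parts_sum := by rw [Multiset.sum_cons, p.parts_sum, add_comm]

/-- Removing a part of size `d` from a partition of `m + d`. -/
def Nat.Partition.erasePart {m d : ℕ} (p : Nat.Partition (m + d)) (hd : d ∈ p.parts) :
    Nat.Partition m where
  parts := p.parts.erase d
  parts_pos hi := p.parts_pos (Multiset.mem_of_mem_erase hi)
  parts_sum := by
    have h := Multiset.sum_erase hd
    rw [p.parts_sum] at h
    omega

theorem partnum_succ_add (k m : ℕ) :
    partnum (k + 1) (m + (k + 1)) = partnum k (m + (k + 1)) + partnum (k + 1) m := by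
  classical
  unfold partnum
  rw [← Fintype.card_sum]
  refine Fintype.card_congr (Equiv.trans (Equiv.sumCompl fun p => k + 1 ∉ p.1.parts).symm
    (Equiv.sumCongr ((Equiv.subtypeSubtypeEquivSubtypeInter _
      (fun p : Nat.Partition (m + (k + 1)) => k + 1 ∉ p.parts)).trans
      (Equiv.subtypeEquivRight fun p => ?_)) ?_))
  · constructor
    · rintro ⟨hle, hnot⟩ j hj
      have hne : j ≠ k + 1 := fun h => hnot (h ▸ hj)
      have := hle j hj
      omega
    · intro h
      exact ⟨fun j hj => (h j hj).trans k.le_succ, fun hk => by have := h _ hk; omega⟩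
  · exact
      { toFun := fun p => ⟨p.1.1.erasePart (not_not.1 p.2),
          fun j hj => p.1.2 j (Multiset.mem_of_mem_erase hj)⟩
        invFun := fun p => ⟨⟨p.1.consPart (k + 1) k.succ_pos, fun j hj => by
            rcases Multiset.mem_cons.1 hj with rfl | hj
            exacts [le_rfl, p.2 j hj]⟩,
          not_not.2 (Multiset.mem_cons_self _ _)⟩
        left_inv := fun p => Subtype.ext <| Subtype.ext <| Nat.Partition.ext <|
          Multiset.cons_erase (not_not.1 p.2)
        right_inv := fun p => Subtype.ext <| Nat.Partition.ext <|
          Multiset.erase_cons_head _ _ }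

theorem partnum_one (m : ℕ) : partnum 1 m = 1 := by
  induction m with
  | zero => exact partnum_zero_right 1
  | succ m ih => rw [partnum_succ_add 0 m, partnum_zero_succ, ih]

theorem Nat.add_pow_succ_le (m d k : ℕ) :
    (m + d) ^ (k + 1) ≤ m ^ (k + 1) + (k + 1) * d * (m + d) ^ k := by
  induction k with
  | zero => simp
  | succ k ih =>
    have h : d * m ^ (k + 1) ≤ d * (m + d) ^ (k + 1) := by gcongr; omega
    calc (m + d) ^ (k + 1 + 1) = (m + d) * (m + d) ^ (k + 1) := by ring
      _ ≤ (m + d) * (m ^ (k + 1) + (k + 1) * d * (m + d) ^ k) := by gcongr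
      _ = m ^ (k + 1 + 1) + d * m ^ (k + 1) + (k + 1) * d * (m + d) ^ (k + 1) := by ring
      _ ≤ m ^ (k + 1 + 1) + d * (m + d) ^ (k + 1) + (k + 1) * d * (m + d) ^ (k + 1) := by gcongr
      _ = _ := by ring

theorem Nat.le_add_pow_succ (m d k : ℕ) :
    m ^ (k + 1) + (k + 1) * d * m ^ k ≤ (m + d) ^ (k + 1) := by
  induction k with
  | zero => simp
  | succ k ih =>
    calc m ^ (k + 1 + 1) + (k + 1 + 1) * d * m ^ (k + 1)
        ≤ m ^ (k + 1 + 1) + (k + 1 + 1) * d * m ^ (k + 1) + (k + 1) * d * d * m ^ k :=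
          Nat.le_add_right _ _
      _ = (m + d) * (m ^ (k + 1) + (k + 1) * d * m ^ k) := by ring
      _ ≤ (m + d) * (m + d) ^ (k + 1) := by gcongr
      _ = _ := by ring

theorem pow_le_partnum_mul_factorial (k m : ℕ) :
    m ^ k ≤ partnum (k + 1) m * (k + 1).factorial * k.factorial := by
  induction k generalizing m with
  | zero => simp [partnum_one]
  | succ k ihk =>
    have hstep (n : ℕ) : (k + 1) * (k + 2) * n ^ k ≤
        partnum (k + 1) n * (k + 2).factorial * (k + 1).factorial := by
      calc (k + 1) * (k + 2) * n ^ k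
          ≤ (k + 1) * (k + 2) * (partnum (k + 1) n * (k + 1).factorial * k.factorial) := by
            gcongr; exact ihk n
        _ = _ := by rw [Nat.factorial_succ (k + 1), Nat.factorial_succ k]; ring
    induction m using Nat.strong_induction_on with
    | _ m ihm =>
      rcases lt_or_ge m (k + 2) with h | h
      · rw [partnum_succ_of_lt h]
        refine le_trans ?_ (hstep m)
        rw [pow_succ']
        gcongr
        nlinarith
      · obtain ⟨n, rfl⟩ := Nat.exists_eq_add_of_le' h
        rw [partnum_succ_add (k + 1) n, add_mul, add_mul]
        have h₁ := ihm n (by omega)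
        have h₂ := hstep (n + (k + 2))
        have h₃ := Nat.add_pow_succ_le n (k + 2) k
        exact h₃.trans ((add_le_add h₁ h₂).trans_eq (add_comm _ _))

theorem exists_partnum_mul_factorial_le (k : ℕ) :
    ∃ c : ℕ, ∀ m, partnum (k + 1) m * (k + 1).factorial * k.factorial ≤ (m + c) ^ k := by
  induction k with
  | zero => exact ⟨0, fun m => by simp [partnum_one]⟩
  | succ k ihk =>
    obtain ⟨c, hc⟩ := ihk
    have hstep (n : ℕ) : partnum (k + 1) n * (k + 2).factorial * (k + 1).factorial ≤
        (k + 1) * (k + 2) * (n + c) ^ k := by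
      calc partnum (k + 1) n * (k + 2).factorial * (k + 1).factorial
          = (k + 1) * (k + 2) * (partnum (k + 1) n * (k + 1).factorial * k.factorial) := by
            rw [Nat.factorial_succ (k + 1), Nat.factorial_succ k]; ring
        _ ≤ _ := by gcongr; exact hc n
    refine ⟨c + (k + 2), fun m => ?_⟩
    induction m using Nat.strong_induction_on with
    | _ m ihm =>
      have hpow := Nat.le_add_pow_succ (m + c) (k + 2) k
      rw [← add_assoc]
      rcases lt_or_ge m (k + 2) with h | h
      · rw [partnum_succ_of_lt h]
        exact (hstep m).trans ((Nat.le_add_left _ _).trans hpow)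
      · obtain ⟨n, rfl⟩ := Nat.exists_eq_add_of_le' h
        rw [partnum_succ_add (k + 1) n, add_mul, add_mul]
        have h₁ := ihm n (by omega)
        rw [show n + (c + (k + 2)) = n + (k + 2) + c by ring] at h₁
        exact (add_le_add (hstep _) h₁).trans ((add_comm _ _).trans_le hpow)

/-- For `k ≥ 1`, `p_k(m) ∼ m^(k-1) / (k! (k-1)!)` as `m → ∞`:
`p_k(m) · k! · (k-1)! / m^(k-1) → 1`. -/
theorem partnum_asymptotics (k : ℕ) (hk : 1 ≤ k) :
    Tendsto
      (fun m : ℕ =>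
        (partnum k m : ℝ) * (Nat.factorial k) * (Nat.factorial (k - 1)) / (m : ℝ) ^ (k - 1))
      atTop (nhds 1) := by
  obtain ⟨k, rfl⟩ := Nat.exists_eq_add_of_le' hk
  obtain ⟨c, hc⟩ := exists_partnum_mul_factorial_le k
  rw [Nat.add_sub_cancel]
  have hlim : Tendsto (fun m : ℕ => (1 + (c : ℝ) / m) ^ k) atTop (nhds 1) := by
    simpa using ((tendsto_const_div_atTop_nhds_zero_nat (c : ℝ)).const_add 1).pow k
  refine tendsto_of_tendsto_of_tendsto_of_le_of_le' tendsto_const_nhds hlim ?_ ?_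
  · filter_upwards [eventually_gt_atTop 0] with m hm
    have hm' : (0 : ℝ) < m := Nat.cast_pos.2 hm
    rw [le_div_iff₀ (by positivity), one_mul]
    exact_mod_cast pow_le_partnum_mul_factorial k m
  · filter_upwards [eventually_gt_atTop 0] with m hm
    have hm' : (0 : ℝ) < m := Nat.cast_pos.2 hm
    rw [div_le_iff₀ (by positivity), ← mul_pow, add_mul, div_mul_cancel₀ _ hm'.ne', one_mul]
    exact_mod_cast hc m
end
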